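/- arXiv:2307.09340 — 5 statements merged into one kernel-verified Lean document; each statement's English description precedes it below -/
import Mathlib

section
/- Let A be a unital real Banach algebra and T ∈ A. The S-spectrum is upper semi-continuous at T: for every open set U ⊆ ℍ with σ_S(T) ⊆ U there exists δ > 0 such that every S ∈ A with ‖S − T‖ < δ satisfies σ_S(S) ⊆ U. -/
/-- The operator `𝒬_q(T) = T² − 2(Re q)•T + ‖q‖²•1` associated to `T` and a quaternion `q`. -/
noncomputable def Qop {A : Type*} [NormedRing A] [NormedAlgebra ℝ A]
    (T : A) (q : Quaternion ℝ) : A :=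
  T ^ 2 - (2 * q.re) • T + (‖q‖ ^ 2) • (1 : A)

/-- The S-spectrum of `T`. -/
noncomputable def sSpectrum {A : Type*} [NormedRing A] [NormedAlgebra ℝ A]
    (T : A) : Set (Quaternion ℝ) :=
  {q | ¬ IsUnit (Qop T q)}

theorem continuous_Qop {A : Type*} [NormedRing A] [NormedAlgebra ℝ A] :
    Continuous fun p : A × Quaternion ℝ => Qop p.1 p.2 := by
  unfold Qop
  have hre : Continuous fun p : A × Quaternion ℝ => p.2.re :=
    Quaternion.continuous_re.comp continuous_snd
  fun_prop

theorem isUnit_Qop_of_lt_norm {A : Type*} [NormedRing A] [CompleteSpace A] [NormedAlgebra ℝ A]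
    {S : A} {q : Quaternion ℝ} (h : 3 * ‖S‖ < ‖q‖) : IsUnit (Qop S q) := by
  have hq : 0 < ‖q‖ := lt_of_le_of_lt (by positivity) h
  have hq2 : ‖q‖ ^ 2 ≠ 0 := by positivity
  have hre : |q.re| ≤ ‖q‖ := by
    refine abs_le_of_sq_le_sq ?_ hq.le
    rw [sq ‖q‖, ← Quaternion.normSq_eq_norm_mul_self, Quaternion.normSq_def']
    nlinarith [sq_nonneg q.imI, sq_nonneg q.imJ, sq_nonneg q.imK]
  set t : A := (‖q‖ ^ 2)⁻¹ • ((2 * q.re) • S - S ^ 2) with ht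
  have hfactor : Qop S q = (‖q‖ ^ 2) • (1 - t) := by
    rw [ht, smul_sub, smul_inv_smul₀ hq2, Qop]
    abel
  have hnum : ‖(2 * q.re) • S - S ^ 2‖ ≤ 2 * ‖q‖ * ‖S‖ + ‖S‖ ^ 2 := by
    refine (norm_sub_le _ _).trans (add_le_add ?_ (norm_pow_le' S two_pos))
    rw [norm_smul, Real.norm_eq_abs, abs_mul, abs_two]
    gcongr
  have ht1 : ‖t‖ < 1 := by
    rw [ht, norm_smul, norm_inv, Real.norm_of_nonneg (by positivity), inv_mul_lt_one₀ (by positivity)]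
    nlinarith [norm_nonneg S]
  rw [hfactor]
  exact (isUnit_one_sub_of_norm_lt_one ht1).smul (Units.mk0 _ hq2)

theorem stmt3 {A : Type*} [NormedRing A] [CompleteSpace A] [NormedAlgebra ℝ A]
    (T : A) (U : Set (Quaternion ℝ)) (hU : IsOpen U) (hTU : sSpectrum T ⊆ U) :
    ∃ δ > 0, ∀ S : A, ‖S - T‖ < δ → sSpectrum S ⊆ U := by
  have hK : IsCompact (Metric.closedBall (0 : Quaternion ℝ) (3 * (‖T‖ + 1)) \ U) :=
    (isCompact_closedBall _ _).diff hU
  have hunit : ∀ᶠ S in nhds T, ∀ q ∈ Metric.closedBall (0 : Quaternion ℝ) (3 * (‖T‖ + 1)) \ U,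
      IsUnit (Qop S q) := by
    refine hK.eventually_forall_of_forall_eventually fun q hq => ?_
    have hTq : IsUnit (Qop T q) := not_not.mp fun h => hq.2 (hTU h)
    exact continuous_Qop.continuousAt.eventually (Units.isOpen.mem_nhds hTq)
  obtain ⟨δ, hδ, hball⟩ := Metric.eventually_nhds_iff.mp hunit
  refine ⟨min δ 1, lt_min hδ one_pos, fun S hS q hq => ?_⟩
  by_contra hqU
  refine hq (hball (by simpa [dist_eq_norm] using hS.trans_le (min_le_left _ _)) q ⟨?_, hqU⟩)
  rw [mem_closedBall_zero_iff]
  by_contra! hlarge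
  refine hq (isUnit_Qop_of_lt_norm ?_)
  linarith [norm_sub_norm_le S T, hS.trans_le (min_le_right δ 1)]
end

section
/- Let A be a unital real Banach algebra, T ∈ A, q ∈ ℍ, and let P ∈ A be an idempotent (P² = P) with T·P = P·T. Set 𝒬 := T² − 2(Re q)•T + ‖q‖²•1. Assume that (i) 𝒬·(1 − P) + P is invertible in A and (ii) limₙ ‖(𝒬·P)ⁿ‖^{1/n} = 0 (these conditions hold when P is the Riesz projection associated to the isolated 2-sphere [q] of the S-spectrum of T: 𝒬·P is quasi-nilpotent and 𝒬 restricted to the kernel of P is invertible). Then 𝒬 + P is invertible in A. -/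
open Filter

theorem isUnit_one_sub_of_isUnit_one_sub_pow {R : Type*} [Ring R] {x : R} {n : ℕ}
    (h : IsUnit (1 - x ^ n)) : IsUnit (1 - x) := by
  rw [← mul_neg_geom_sum] at h
  have hc : Commute (1 - x) (∑ i ∈ Finset.range n, x ^ i) :=
    (mul_neg_geom_sum x n).trans (geom_sum_mul_neg x n).symm
  exact (hc.isUnit_mul_iff.mp h).1

theorem isUnit_one_add_of_tendsto_norm_pow_rpow {A : Type*} [NormedRing A] [CompleteSpace A]
    {x : A} (hx : Tendsto (fun n : ℕ => ‖x ^ n‖ ^ (1 / (n : ℝ))) atTop (nhds 0)) :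
    IsUnit (1 + x) := by
  obtain ⟨n, hn, hn0⟩ :=
    ((hx.eventually (gt_mem_nhds one_pos)).and (eventually_gt_atTop 0)).exists
  have hlt : ‖x ^ n‖ < 1 := by
    by_contra! h
    exact hn.not_ge (Real.one_le_rpow h (by positivity))
  rw [← sub_neg_eq_add]
  refine isUnit_one_sub_of_isUnit_one_sub_pow (n := n) (isUnit_one_sub_of_norm_lt_one ?_)
  rw [neg_pow]
  rcases neg_one_pow_eq_or A n with h | h <;> simpa [h] using hlt

theorem stmt7 {A : Type*} [NormedRing A] [CompleteSpace A] [NormedAlgebra ℝ A]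
    (T P : A) (q : Quaternion ℝ)
    (hP : P ^ 2 = P) (hTP : T * P = P * T)
    (Q : A) (hQ : Q = T ^ 2 - (2 * q.re) • T + (‖q‖ ^ 2) • (1 : A))
    (hinv : IsUnit (Q * (1 - P) + P))
    (hqn : Tendsto (fun n : ℕ => ‖(Q * P) ^ n‖ ^ (1 / (n : ℝ))) atTop (nhds 0)) :
    IsUnit (Q + P) := by
  have hT : Commute T P := hTP
  have hQP : Q * P = P * Q := by
    rw [hQ]
    exact (((hT.pow_left 2).sub_left (hT.smul_left _)).add_left
      ((Commute.one_left P).smul_left _)).eq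
  have hPP : P * P = P := by rw [← sq, hP]
  have hPQP : P * (Q * P) = Q * P := by rw [hQP, ← mul_assoc, hPP]
  have key : (Q * (1 - P) + P) * (1 + Q * P) = Q + P := by
    have h0 : (1 - P) * (Q * P) = 0 := by rw [sub_mul, one_mul, hPQP, sub_self]
    rw [mul_add, mul_one, add_mul, mul_assoc Q, h0, mul_zero, zero_add, hPQP, mul_sub, mul_one]
    abel
  rw [← key]
  exact hinv.mul (isUnit_one_add_of_tendsto_norm_pow_rpow hqn)
end

section
/- Let A be a unital ring that is an associative algebra over ℝ, let j : ℍ → A be a unital ℝ-algebra homomorphism, let T ∈ A and q ∈ ℍ. Let P ∈ A satisfy P² = P, P·T = T·P and P·j(x) = j(x)·P for all x ∈ ℍ, and assume u := 𝒬_q(T)·(1 − P) + P is invertible in A. Define the left Browder S-resolvent S_{L,B} := −u⁻¹·(T − j(q̄))·(1 − P) − P. Then the left Browder S-resolvent equation holds: S_{L,B}·(1 − P)·j(q) − T·(1 − P)·S_{L,B} + P = 1. -/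
/-- `𝒬_q(T) = T² − 2(Re q)•T + ‖q‖²•1` in an associative unital ℝ-algebra. -/
noncomputable def QopA {A : Type*} [Ring A] [Algebra ℝ A] (T : A) (q : Quaternion ℝ) : A :=
  T ^ 2 - (2 * q.re) • T + (‖q‖ ^ 2) • (1 : A)

/-- `𝒬_q(T)` is the difference of `T - q̄` multiplied by `T` on the left and by `q` on the right. -/
theorem QopA_eq_sub {A : Type*} [Ring A] [Algebra ℝ A] (j : Quaternion ℝ →ₐ[ℝ] A) (T : A)
    (q : Quaternion ℝ) :
    QopA T q = T * (T - j (star q)) - (T - j (star q)) * j q := by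
  have hsum : j q + j (star q) = algebraMap ℝ A (2 * q.re) := by
    rw [← map_add, Quaternion.self_add_star', ← j.commutes]
    rfl
  have hmul : j (star q) * j q = algebraMap ℝ A (‖q‖ ^ 2) := by
    rw [← map_mul, Quaternion.star_mul_self, Quaternion.normSq_eq_norm_mul_self, ← sq,
      ← j.commutes]
    rfl
  rw [QopA, Algebra.smul_def, Algebra.commutes _ T, Algebra.smul_def, mul_one, ← hmul, ← hsum]
  noncomm_ring

/-- `𝒬_q(T)` commutes with everything that commutes with `T`. -/
theorem Commute.QopA_right {A : Type*} [Ring A] [Algebra ℝ A] {x T : A} (h : Commute x T)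
    (q : Quaternion ℝ) : Commute x (QopA T q) :=
  ((h.pow_right 2).sub_right (h.smul_right _)).add_right ((Commute.one_right x).smul_right _)

theorem stmt8 {A : Type*} [Ring A] [Algebra ℝ A]
    (j : Quaternion ℝ →ₐ[ℝ] A) (T : A) (q : Quaternion ℝ) (P : A)
    (hP : P ^ 2 = P) (hPT : P * T = T * P) (hPj : ∀ x : Quaternion ℝ, P * j x = j x * P)
    (u : Aˣ) (hu : (u : A) = QopA T q * (1 - P) + P) :
    (-(((u⁻¹ : Aˣ) : A) * (T - j (star q)) * (1 - P)) - P) * (1 - P) * j q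
      - T * (1 - P) * (-(((u⁻¹ : Aˣ) : A) * (T - j (star q)) * (1 - P)) - P) + P = 1 := by
  have hPP : P * P = P := by rw [← sq, hP]
  have hT : Commute P T := hPT
  have hPv : Commute P ((u⁻¹ : Aˣ) : A) := by
    refine Commute.units_inv_right ?_
    rw [hu]
    exact ((hT.QopA_right q).mul_right ((Commute.one_right P).sub_right (Commute.refl P))).add_right
      (Commute.refl P)
  have hTv : Commute T ((u⁻¹ : Aˣ) : A) := by
    refine Commute.units_inv_right ?_
    rw [hu]
    exact (((Commute.refl T).QopA_right q).mul_right
      ((Commute.one_right T).sub_right hT.symm)).add_right hT.symm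
  have huP : (u : A) * P = P := by
    rw [hu, add_mul, mul_assoc, sub_mul, one_mul, hPP, sub_self, mul_zero, zero_add]
  have hvP : ((u⁻¹ : Aˣ) : A) * P = P := (Units.inv_mul_eq_iff_eq_mul u).2 huP.symm
  have hQ : QopA T q * (1 - P) = u - P := by rw [hu, add_sub_cancel_right]
  have hvu : ((u⁻¹ : Aˣ) : A) * u = 1 := u.inv_mul
  generalize ((u⁻¹ : Aˣ) : A) = v at *
  set D := T - j (star q) with hD
  have hRR : (1 - P) * (1 - P) = 1 - P := by rw [mul_sub, mul_one, sub_mul, one_mul, hPP]; simp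
  have hPR : P * (1 - P) = 0 := by rw [mul_sub, mul_one, hPP, sub_self]
  have hRP : (1 - P) * P = 0 := by rw [sub_mul, one_mul, hPP, sub_self]
  have hRj : (1 - P) * j q = j q * (1 - P) := by rw [sub_mul, mul_sub, hPj, one_mul, mul_one]
  have hRD : (1 - P) * D = D * (1 - P) :=
    (Commute.one_left D).sub_left (hT.sub_right (hPj (star q)))
  have hRv : (1 - P) * v = v * (1 - P) := (Commute.one_left v).sub_left hPv
  have hleft : (-(v * D * (1 - P)) - P) * (1 - P) * j q = -(v * (D * j q * (1 - P))) := by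
    rw [sub_mul, hPR, sub_zero, neg_mul, mul_assoc _ (1 - P), hRR, neg_mul, mul_assoc _ (1 - P),
      hRj]
    simp only [mul_assoc]
  have hright : T * (1 - P) * (-(v * D * (1 - P)) - P) = -(v * (T * D * (1 - P))) := by
    rw [mul_sub, mul_assoc T _ P, hRP, mul_zero, sub_zero, mul_neg]
    calc -(T * (1 - P) * (v * D * (1 - P))) = -(T * (((1 - P) * v) * D * (1 - P))) := by
          simp only [mul_assoc]
      _ = -(T * v * (((1 - P) * D) * (1 - P))) := by rw [hRv]; simp only [mul_assoc]
      _ = -(v * T * (D * ((1 - P) * (1 - P)))) := by rw [hRD, hTv.eq]; simp only [mul_assoc]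
      _ = -(v * (T * D * (1 - P))) := by rw [hRR]; simp only [mul_assoc]
  calc _ = v * ((T * D - D * j q) * (1 - P)) + P := by
        rw [hleft, hright, sub_mul (T * D), mul_sub v]; abel
    _ = 1 := by rw [hD, ← QopA_eq_sub, hQ, mul_sub, hvu, hvP, sub_add_cancel]
end

section
/- Let A be a unital ring that is an associative algebra over ℝ, let j : ℍ → A be a unital ℝ-algebra homomorphism, let T ∈ A and q ∈ ℍ. Let P ∈ A satisfy P² = P, P·T = T·P and P·j(x) = j(x)·P for all x ∈ ℍ, and assume u := 𝒬_q(T)·(1 − P) + P is invertible in A. Define the right Browder S-resolvent S_{R,B} := −(T − j(q̄))·(1 − P)·u⁻¹ − P. Then the right Browder S-resolvent equation holds: j(q)·(1 − P)·S_{R,B} − S_{R,B}·(1 − P)·T + P = 1. -/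
theorem map_add_map_star {A : Type*} [Ring A] [Algebra ℝ A] (j : Quaternion ℝ →ₐ[ℝ] A)
    (q : Quaternion ℝ) : j q + j (star q) = (2 * q.re) • (1 : A) := by
  rw [← map_add, Quaternion.self_add_star', ← Quaternion.algebraMap_def, AlgHom.commutes,
    Algebra.algebraMap_eq_smul_one]

theorem map_mul_map_star {A : Type*} [Ring A] [Algebra ℝ A] (j : Quaternion ℝ →ₐ[ℝ] A)
    (q : Quaternion ℝ) : j q * j (star q) = (‖q‖ ^ 2) • (1 : A) := by
  rw [← map_mul, Quaternion.self_mul_star, ← Quaternion.algebraMap_def, AlgHom.commutes,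
    Algebra.algebraMap_eq_smul_one, Quaternion.normSq_eq_norm_mul_self, sq]

theorem sub_mul_self_sub_mul_sub_eq_QopA {A : Type*} [Ring A] [Algebra ℝ A]
    (j : Quaternion ℝ →ₐ[ℝ] A) (T : A) (q : Quaternion ℝ) :
    (T - j (star q)) * T - j q * (T - j (star q)) = QopA T q := by
  have h : (2 * q.re) • T = (j q + j (star q)) * T := by
    rw [map_add_map_star, smul_mul_assoc, one_mul]
  rw [QopA, h, ← map_mul_map_star j q]
  noncomm_ring

theorem commute_QopA {A : Type*} [Ring A] [Algebra ℝ A] {S T : A} (h : Commute S T)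
    (q : Quaternion ℝ) : Commute S (QopA T q) :=
  ((h.pow_right 2).sub_right (h.smul_right _)).add_right ((Commute.one_right S).smul_right _)

theorem stmt9 {A : Type*} [Ring A] [Algebra ℝ A]
    (j : Quaternion ℝ →ₐ[ℝ] A) (T : A) (q : Quaternion ℝ) (P : A)
    (hP : P ^ 2 = P) (hPT : P * T = T * P) (hPj : ∀ x : Quaternion ℝ, P * j x = j x * P)
    (u : Aˣ) (hu : (u : A) = QopA T q * (1 - P) + P) :
    j q * (1 - P) * (-((T - j (star q)) * (1 - P) * ((u⁻¹ : Aˣ) : A)) - P)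
      - (-((T - j (star q)) * (1 - P) * ((u⁻¹ : Aˣ) : A)) - P) * (1 - P) * T + P = 1 := by
  set E : A := 1 - P with hE
  set v : A := ((u⁻¹ : Aˣ) : A) with hv
  have hPP : P * P = P := by rw [← sq, hP]
  have hEE : E * E = E := by rw [hE, mul_sub, sub_mul, sub_mul, hPP]; simp
  have hEP : E * P = 0 := by rw [hE, sub_mul, hPP, one_mul, sub_self]
  have hPE : P * E = 0 := by rw [hE, mul_sub, hPP, mul_one, sub_self]
  have commute_E {x : A} (hx : Commute P x) : Commute E x := (Commute.one_left x).sub_left hx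
  have hET : Commute E T := commute_E hPT
  have commute_v {x : A} (hxT : Commute x T) (hxP : Commute x P) : Commute x v := by
    refine Commute.units_inv_right ?_
    rw [hu]
    exact ((commute_QopA hxT q).mul_right ((Commute.one_right x).sub_right hxP)).add_right hxP
  have hTv : Commute T v := commute_v (Commute.refl T) hPT.symm
  have hEv : Commute E v := commute_v hET (commute_E (Commute.refl P))
  have hPu : P * u = P := by
    rw [hu, mul_add, ← mul_assoc, (commute_QopA hPT q).eq, mul_assoc, hPE, mul_zero, hPP, zero_add]
  have hPv : P * v = P := by rw [hv, Units.mul_inv_eq_iff_eq_mul, hPu]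
  have hleft : j q * E * ((T - j (star q)) * E * v) = j q * (T - j (star q)) * (E * v) := by
    have h : Commute E (T - j (star q)) := hET.sub_right (commute_E (hPj _))
    calc _ = j q * (E * (T - j (star q))) * E * v := by noncomm_ring
      _ = j q * (T - j (star q)) * (E * E) * v := by rw [h.eq]; noncomm_ring
      _ = _ := by rw [hEE, mul_assoc]
  have hright : (T - j (star q)) * E * v * E * T = (T - j (star q)) * T * (E * v) := by
    calc _ = (T - j (star q)) * (E * (v * E) * T) := by simp only [mul_assoc]
      _ = (T - j (star q)) * (E * v * T) := by rw [← hEv.eq, ← mul_assoc E, hEE]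
      _ = _ := by rw [(hET.mul_left hTv.symm).eq, mul_assoc]
  have hQ : QopA T q * E = u - P := by rw [hu, add_sub_cancel_right]
  calc _ = (T - j (star q)) * E * v * E * T - j q * E * ((T - j (star q)) * E * v)
        - j q * (E * P) + P * E * T + P := by noncomm_ring
    _ = ((T - j (star q)) * T - j q * (T - j (star q))) * (E * v) + P := by
      rw [hleft, hright, hEP, hPE, mul_zero, zero_mul, sub_zero, add_zero, ← sub_mul]
    _ = 1 := by
      rw [sub_mul_self_sub_mul_sub_eq_QopA, ← mul_assoc, hQ, sub_mul, hPv, hv, Units.mul_inv,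
        sub_add_cancel]
end

section
/- Let A be a unital ring that is an associative algebra over ℝ, let j : ℍ → A be a unital ℝ-algebra homomorphism, let T ∈ A, and let s, p ∈ ℍ be such that 𝒬_s(T) and 𝒬_p(T) are invertible in A. Define S_R := −(T − j(s̄))·𝒬_s(T)⁻¹ and S_L := −𝒬_p(T)⁻¹·(T − j(p̄)). Then the S-resolvent equation holds: S_R·S_L·j(p² − 2(Re s)p + ‖s‖²) = (S_R − S_L)·j(p) + j(s̄)·(S_L − S_R). -/
section QuaternionOperators

variable {A : Type*} [Ring A] [Algebra ℝ A] (j : Quaternion ℝ →ₐ[ℝ] A) (T : A) (q : Quaternion ℝ)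

theorem map_real_coe_quaternion (r : ℝ) : j (r : Quaternion ℝ) = r • (1 : A) := by
  rw [← Algebra.algebraMap_eq_smul_one]
  exact j.commutes r

theorem map_add_map_star_quaternion : j q + j (star q) = (2 * q.re) • (1 : A) := by
  rw [← map_add, Quaternion.self_add_star, ← map_real_coe_quaternion j]
  push_cast
  rfl

theorem map_mul_map_star_quaternion : j q * j (star q) = (‖q‖ ^ 2) • (1 : A) := by
  rw [← map_mul, Quaternion.self_mul_star, Quaternion.normSq_eq_norm_mul_self,
    map_real_coe_quaternion, sq]

theorem map_star_mul_map_quaternion : j (star q) * j q = (‖q‖ ^ 2) • (1 : A) := by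
  simpa using map_mul_map_star_quaternion j (star q)

theorem QopA_commute_self : Commute (QopA T q) T := by
  unfold QopA
  exact (((Commute.refl T).pow_left 2).sub_left ((Commute.refl T).smul_left _)).add_left
    ((Commute.one_left T).smul_left _)

theorem map_mul_sub_sub_mul_eq_neg_QopA :
    j q * (T - j (star q)) - (T - j (star q)) * T = -QopA T q := by
  have h : j q * T + j (star q) * T = (2 * q.re) • T := by
    rw [← add_mul, map_add_map_star_quaternion, smul_one_mul]
  rw [QopA, ← h, ← map_mul_map_star_quaternion j q]
  noncomm_ring

theorem sub_mul_map_sub_mul_eq_neg_QopA :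
    (T - j (star q)) * j q - T * (T - j (star q)) = -QopA T q := by
  have h : T * j q + T * j (star q) = (2 * q.re) • T := by
    rw [← mul_add, map_add_map_star_quaternion, mul_smul_one]
  rw [QopA, ← h, ← map_star_mul_map_quaternion j q]
  noncomm_ring

/-- The right S-resolvent operator satisfies `q S - S T = 1`. -/
theorem right_resolvent_equation (u : Aˣ) (hu : (u : A) = QopA T q) :
    j q * -((T - j (star q)) * (↑u⁻¹ : A)) - -((T - j (star q)) * (↑u⁻¹ : A)) * T = 1 := by
  have hc : (↑u⁻¹ : A) * T = T * ↑u⁻¹ :=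
    (Commute.units_inv_left (hu ▸ QopA_commute_self T q)).eq
  calc
    _ = -(j q * (T - j (star q)) * ↑u⁻¹ - (T - j (star q)) * (↑u⁻¹ * T)) := by noncomm_ring
    _ = -((j q * (T - j (star q)) - (T - j (star q)) * T) * ↑u⁻¹) := by
      rw [hc, sub_mul _ _ (↑u⁻¹ : A), mul_assoc _ T]
    _ = 1 := by rw [map_mul_sub_sub_mul_eq_neg_QopA, ← hu, neg_mul, neg_neg, Units.mul_inv]

/-- The left S-resolvent operator satisfies `S q - T S = 1`. -/
theorem left_resolvent_equation (u : Aˣ) (hu : (u : A) = QopA T q) :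
    -((↑u⁻¹ : A) * (T - j (star q))) * j q - T * -((↑u⁻¹ : A) * (T - j (star q))) = 1 := by
  have hc : (↑u⁻¹ : A) * T = T * ↑u⁻¹ :=
    (Commute.units_inv_left (hu ▸ QopA_commute_self T q)).eq
  calc
    _ = -(↑u⁻¹ * ((T - j (star q)) * j q) - T * ↑u⁻¹ * (T - j (star q))) := by noncomm_ring
    _ = -(↑u⁻¹ * ((T - j (star q)) * j q - T * (T - j (star q)))) := by
      rw [← hc, mul_sub (↑u⁻¹ : A) (_ * _), mul_assoc _ T]
    _ = 1 := by rw [sub_mul_map_sub_mul_eq_neg_QopA, ← hu, mul_neg, neg_neg, Units.inv_mul]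

end QuaternionOperators

theorem stmt12 {A : Type*} [Ring A] [Algebra ℝ A]
    (j : Quaternion ℝ →ₐ[ℝ] A) (T : A) (s p : Quaternion ℝ)
    (us up : Aˣ)
    (hus : (us : A) = QopA T s) (hup : (up : A) = QopA T p)
    (SR SL : A)
    (hSR : SR = -((T - j (star s)) * ((us⁻¹ : Aˣ) : A)))
    (hSL : SL = -(((up⁻¹ : Aˣ) : A) * (T - j (star p)))) :
    SR * SL * j (p ^ 2 - 2 * (s.re : Quaternion ℝ) * p + ((‖s‖ ^ 2 : ℝ) : Quaternion ℝ))
      = (SR - SL) * j p + j (star s) * (SL - SR) := by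
  have hR : j s * SR - SR * T = 1 := hSR ▸ right_resolvent_equation j T s us hus
  have hL : SL * j p - T * SL = 1 := hSL ▸ left_resolvent_equation j T p up hup
  have hX : SR * SL * j p = SR - SL + j s * (SR * SL) := by
    calc
      _ = SR * (SL * j p - T * SL) - (j s * SR - SR * T) * SL + j s * (SR * SL) := by
        noncomm_ring
      _ = _ := by rw [hR, hL, mul_one, one_mul]
  have hpoly : j (p ^ 2 - 2 * (s.re : Quaternion ℝ) * p + ((‖s‖ ^ 2 : ℝ) : Quaternion ℝ))
      = j p * j p - (2 * s.re) • j p + (‖s‖ ^ 2) • (1 : A) := by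
    have h2 : (2 * (s.re : Quaternion ℝ)) = ((2 * s.re : ℝ) : Quaternion ℝ) := by
      push_cast
      rfl
    rw [h2, map_add, map_sub, map_mul, map_real_coe_quaternion, map_real_coe_quaternion, map_pow,
      sq, smul_one_mul]
  have hre : (2 * s.re) • (SR * SL * j p) = (j s + j (star s)) * (SR * SL * j p) := by
    rw [map_add_map_star_quaternion, smul_one_mul]
  have hnorm : (‖s‖ ^ 2) • (SR * SL) = j (star s) * j s * (SR * SL) := by
    rw [map_star_mul_map_quaternion, smul_one_mul]
  calc
    _ = SR * SL * j p * j p - (2 * s.re) • (SR * SL * j p) + (‖s‖ ^ 2) • (SR * SL) := by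
      rw [hpoly, mul_add, mul_sub, mul_smul_comm, mul_smul_comm, mul_one, ← mul_assoc]
    _ = (SR * SL * j p - j s * (SR * SL)) * j p
        - j (star s) * (SR * SL * j p - j s * (SR * SL)) := by
      rw [hre, hnorm]
      noncomm_ring
    _ = _ := by
      rw [hX]
      noncomm_ring
end
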